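/- Let P be a convex lattice polygon containing exactly g lattice points in total (interior and boundary), with g ≥ 3. Then 3·lw(P)² ≤ 8g − 20, where lw(P) denotes the lattice width of P; equivalently, lw(P) ≤ √((8/3)(g − 5/2)). -/

import Mathlib

/-- The canonical inclusion of the lattice `ℤ²` into the plane `ℝ²`. -/
def toReal2 (p : ℤ × ℤ) : ℝ × ℝ := ((p.1 : ℝ), (p.2 : ℝ))

/-- The lattice points of a subset of the plane. -/
def latticePoints (P : Set (ℝ × ℝ)) : Set (ℤ × ℤ) := {p | toReal2 p ∈ P}

/-- The interior lattice points of a subset of the plane. -/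
def interiorLatticePoints (P : Set (ℝ × ℝ)) : Set (ℤ × ℤ) := {p | toReal2 p ∈ interior P}

/-- The width of `P` in the direction of the integer linear functional `(u,v) ↦ au + bv`,
i.e. the difference between the sup and the inf of this functional on the lattice points
of `P`. -/
noncomputable def dirWidth (P : Set (ℝ × ℝ)) (φ : ℤ × ℤ) : ℤ :=
  sSup ((fun p : ℤ × ℤ => φ.1 * p.1 + φ.2 * p.2) '' latticePoints P) -
    sInf ((fun p : ℤ × ℤ => φ.1 * p.1 + φ.2 * p.2) '' latticePoints P)

/-- The lattice width of `P`: the minimum of the directional widths over all nonzero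
integer linear functionals. -/
noncomputable def latticeWidth (P : Set (ℝ × ℝ)) : ℤ :=
  sInf {w | ∃ φ : ℤ × ℤ, φ ≠ 0 ∧ w = dirWidth P φ}

/-- The determinant of a pair of vectors of `ℤ²`. -/
def det2 (u v : ℤ × ℤ) : ℤ := u.1 * v.2 - u.2 * v.1

/-- Twice the signed area of the triangle `p q r`. -/
def orient (p q r : ℤ × ℤ) : ℤ := det2 (q - p) (r - p)

/-- A finset containing every lattice point of the half-open parallelogram spanned by `u` and `v` has
at least `det2 u v` elements. -/
theorem det2_le_card_of_box_subset {u v : ℤ × ℤ} (hD : 0 < det2 u v) {s : Finset (ℤ × ℤ)}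
    (hs : ∀ x, 0 ≤ det2 x v → det2 x v < det2 u v → 0 ≤ det2 u x → det2 u x < det2 u v → x ∈ s) :
    det2 u v ≤ s.card := by
  have hli : LinearIndependent ℤ ![u, v] := by
    rw [LinearIndependent.pair_iff]
    intro a b hab
    have h1 := congrArg Prod.fst hab
    have h2 := congrArg Prod.snd hab
    simp only [Prod.fst_add, Prod.smul_fst, Prod.snd_add, Prod.smul_snd, smul_eq_mul,
      Prod.fst_zero, Prod.snd_zero] at h1 h2
    constructor
    · refine (mul_eq_zero.1 (?_ : a * det2 u v = 0)).resolve_right hD.ne'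
      unfold det2; linear_combination v.2 * h1 - v.1 * h2
    · refine (mul_eq_zero.1 (?_ : b * det2 u v = 0)).resolve_right hD.ne'
      unfold det2; linear_combination u.1 * h2 - u.2 * h1
  have hcard := Submodule.natAbs_det_basis_change (Module.Basis.finTwoProd ℤ)
    (Submodule.span ℤ (Set.range ![u, v])) (Module.Basis.span hli)
  have hdet : (Module.Basis.finTwoProd ℤ).det
      ((↑) ∘ Module.Basis.span hli : Fin 2 → ℤ × ℤ) = det2 u v := by
    have : ((↑) ∘ Module.Basis.span hli : Fin 2 → ℤ × ℤ) = ![u, v] := by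
      funext i; simp [Module.Basis.span_apply]
    rw [this, Module.Basis.det_apply, Matrix.det_fin_two]
    simp [Module.Basis.toMatrix_apply, det2]
    ring
  rw [hdet] at hcard
  have hsurj : Function.Surjective
      (fun x : s => (Submodule.mkQ (Submodule.span ℤ (Set.range ![u, v]))) x) := by
    intro c
    obtain ⟨x, rfl⟩ := Submodule.mkQ_surjective _ c
    set D := det2 u v with hDdef
    set a := det2 x v / D
    set b := det2 u x / D
    have ha : det2 (x - a • u - b • v) v = det2 x v % D := by
      rw [Int.emod_def]; change _ = _ - D * a; rw [hDdef]; simp [det2]; ring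
    have hb : det2 u (x - a • u - b • v) = det2 u x % D := by
      rw [Int.emod_def]; change _ = _ - D * b; rw [hDdef]; simp [det2]; ring
    refine ⟨⟨x - a • u - b • v, hs _ ?_ ?_ ?_ ?_⟩, ?_⟩
    · rw [ha]; exact Int.emod_nonneg _ hD.ne'
    · rw [ha]; exact Int.emod_lt_of_pos _ hD
    · rw [hb]; exact Int.emod_nonneg _ hD.ne'
    · rw [hb]; exact Int.emod_lt_of_pos _ hD
    · simp only [Submodule.mkQ_apply]
      rw [Submodule.Quotient.eq]
      have hmem : ∀ i, ![u, v] i ∈ Submodule.span ℤ (Set.range ![u, v]) :=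
        fun i => Submodule.subset_span ⟨i, rfl⟩
      have : x - a • u - b • v - x = (-a) • u + (-b) • v := by simp; abel
      rw [this]
      exact Submodule.add_mem _ (Submodule.smul_mem _ _ (hmem 0)) (Submodule.smul_mem _ _ (hmem 1))
  have := Nat.card_le_card_of_surjective _ hsurj
  rw [← hcard, Nat.card_eq_fintype_card, Fintype.card_coe] at this
  omega

/-- A set of lattice points is lattice convex if it contains every lattice point of every triangle
(possibly degenerate) with vertices in it. -/
def LatticeConvex (L : Finset (ℤ × ℤ)) : Prop :=
  ∀ p ∈ L, ∀ q ∈ L, ∀ r ∈ L, ∀ a b c : ℤ, 0 ≤ a → 0 ≤ b → 0 ≤ c → 0 < a + b + c →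
    ∀ x : ℤ × ℤ, (a + b + c) • x = a • p + b • q + c • r → x ∈ L

open Classical in
/-- The points of `L` in the relative interior of the segment `p q`. -/
noncomputable def openEdge (L : Finset (ℤ × ℤ)) (p q : ℤ × ℤ) : Finset (ℤ × ℤ) :=
  L.filter fun x => ∃ a b : ℤ, 0 < a ∧ 0 < b ∧ (a + b) • x = a • p + b • q

theorem mem_openEdge {L : Finset (ℤ × ℤ)} {p q x : ℤ × ℤ} : x ∈ openEdge L p q ↔
    x ∈ L ∧ ∃ a b : ℤ, 0 < a ∧ 0 < b ∧ (a + b) • x = a • p + b • q := by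
  simp [openEdge]

theorem openEdge_comm (L : Finset (ℤ × ℤ)) (p q : ℤ × ℤ) : openEdge L p q = openEdge L q p := by
  ext x
  simp only [mem_openEdge]
  constructor <;> rintro ⟨h, a, b, ha, hb, e⟩ <;>
    exact ⟨h, b, a, hb, ha, by rw [add_comm b a, e, add_comm]⟩

/-- The points of `L` in the triangle `p q r`, without the edge `p q`. -/
def triangleMinusBase (L : Finset (ℤ × ℤ)) (p q r : ℤ × ℤ) : Finset (ℤ × ℤ) :=
  L.filter fun x => 0 < orient p q x ∧ 0 ≤ orient q r x ∧ 0 ≤ orient r p x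

/-- The points of `L` in the interior of the triangle `p q r`. -/
def openTriangle (L : Finset (ℤ × ℤ)) (p q r : ℤ × ℤ) : Finset (ℤ × ℤ) :=
  L.filter fun x => 0 < orient p q x ∧ 0 < orient q r x ∧ 0 < orient r p x

theorem orient_rotate (p q r : ℤ × ℤ) : orient q r p = orient p q r := by
  simp [orient, det2]; ring

theorem orient_swap (p q r : ℤ × ℤ) : orient q p r = -orient p q r := by
  simp [orient, det2]; ring

theorem orient_sum (p q r x : ℤ × ℤ) :
    orient p q x + orient q r x + orient r p x = orient p q r := by
  simp [orient, det2]; ring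

theorem orient_barycentric (p q r x : ℤ × ℤ) :
    orient p q r • x = orient q r x • p + orient r p x • q + orient p q x • r := by
  ext <;> simp [orient, det2] <;> ring

theorem LatticeConvex.mem_of_orient {L : Finset (ℤ × ℤ)} (hL : LatticeConvex L)
    {p q r : ℤ × ℤ} (hp : p ∈ L) (hq : q ∈ L) (hr : r ∈ L) (hD : 0 < orient p q r) {x : ℤ × ℤ}
    (h1 : 0 ≤ orient p q x) (h2 : 0 ≤ orient q r x) (h3 : 0 ≤ orient r p x) : x ∈ L := by
  have hs := orient_sum p q r x
  refine hL p hp q hq r hr _ _ _ h2 h3 h1 (by omega) x ?_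
  rw [← orient_barycentric p q r x]; congr 1; omega

/-- Membership in an open edge of a nondegenerate triangle in barycentric coordinates. -/
theorem mem_openEdge_iff_orient {L : Finset (ℤ × ℤ)} {p q r : ℤ × ℤ} (hD : 0 < orient p q r)
    {x : ℤ × ℤ} : x ∈ openEdge L p q ↔
      x ∈ L ∧ orient p q x = 0 ∧ 0 < orient q r x ∧ 0 < orient r p x := by
  simp only [mem_openEdge]
  refine and_congr_right fun _ => ⟨?_, ?_⟩
  · rintro ⟨a, b, ha, hb, e⟩
    have h1 := congrArg Prod.fst e
    have h2 := congrArg Prod.snd e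
    simp only [Prod.fst_add, Prod.smul_fst, Prod.snd_add, Prod.smul_snd, smul_eq_mul] at h1 h2
    have e1 : (a + b) * orient p q x = 0 := by
      simp only [orient, det2, Prod.fst_sub, Prod.snd_sub]
      linear_combination (q.1 - p.1) * h2 - (q.2 - p.2) * h1
    have e2 : (a + b) * orient q r x = a * orient p q r := by
      simp only [orient, det2, Prod.fst_sub, Prod.snd_sub]
      linear_combination (r.1 - q.1) * h2 - (r.2 - q.2) * h1
    have e3 : (a + b) * orient r p x = b * orient p q r := by
      simp only [orient, det2, Prod.fst_sub, Prod.snd_sub]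
      linear_combination (p.1 - r.1) * h2 - (p.2 - r.2) * h1
    have hab : 0 < a + b := by omega
    refine ⟨(mul_eq_zero.1 e1).resolve_left hab.ne', ?_, ?_⟩
    · exact pos_of_mul_pos_right (e2 ▸ mul_pos ha hD) hab.le
    · exact pos_of_mul_pos_right (e3 ▸ mul_pos hb hD) hab.le
  · rintro ⟨h0, h1, h2⟩
    refine ⟨_, _, h1, h2, ?_⟩
    have := orient_barycentric p q r x
    have hs := orient_sum p q r x
    rw [h0, zero_smul, add_zero] at this
    rw [← this]; congr 1; omega

/-- Pick's inequality for a triangle, with the points of the edge `p q` left out. -/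
theorem orient_le_card_triangleMinusBase {L : Finset (ℤ × ℤ)} (hL : LatticeConvex L)
    {p q r : ℤ × ℤ} (hp : p ∈ L) (hq : q ∈ L) (hr : r ∈ L) (hD : 0 < orient p q r) :
    orient p q r + 1 + (openEdge L q r).card + (openEdge L r p).card ≤
      2 * (triangleMinusBase L p q r).card + (openEdge L p q).card := by
  have hD' : 0 < orient q r p := by rwa [orient_rotate]
  have hD'' : 0 < orient r p q := by rwa [orient_rotate, orient_rotate]
  have hsum := fun x => orient_sum p q r x
  have hsplit : (openTriangle L p q r).card + (openEdge L q r).card + (openEdge L r p).card + 1 ≤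
      (triangleMinusBase L p q r).card := by
    rw [← Finset.card_union_of_disjoint, ← Finset.card_union_of_disjoint, ← Finset.card_singleton r,
      ← Finset.card_union_of_disjoint]
    · refine Finset.card_le_card fun x hx => ?_
      simp only [Finset.mem_union, mem_openEdge_iff_orient hD', mem_openEdge_iff_orient hD'',
        openTriangle, Finset.mem_filter, Finset.mem_singleton] at hx
      simp only [triangleMinusBase, Finset.mem_filter]
      rcases hx with ((h | h) | h) | rfl
      · exact ⟨h.1, h.2.1, h.2.2.1.le, h.2.2.2.le⟩
      · exact ⟨h.1, h.2.2.2, h.2.1.ge, h.2.2.1.le⟩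
      · exact ⟨h.1, h.2.2.1, h.2.2.2.le, h.2.1.ge⟩
      · exact ⟨hr, hD, by simp [orient, det2, mul_comm], by simp [orient, det2]⟩
    · rw [Finset.disjoint_left]
      rintro x hx hx'
      obtain rfl := Finset.mem_singleton.1 hx'
      have h1 : orient q x x = 0 := by simp [orient, det2]; ring
      have h2 : orient x p x = 0 := by simp [orient, det2]
      simp only [Finset.mem_union, mem_openEdge_iff_orient hD', mem_openEdge_iff_orient hD'',
        openTriangle, Finset.mem_filter] at hx
      omega
    · rw [Finset.disjoint_left]
      intro x hx hx'
      simp only [Finset.mem_union, mem_openEdge_iff_orient hD', mem_openEdge_iff_orient hD'',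
        openTriangle, Finset.mem_filter] at hx hx'
      omega
    · rw [Finset.disjoint_left]
      intro x hx hx'
      simp only [mem_openEdge_iff_orient hD', openTriangle, Finset.mem_filter] at hx hx'
      omega
  have hbox : orient p q r ≤ (((triangleMinusBase L p q r ∪ openEdge L p q) ∪
      (openTriangle L p q r).image (fun x => p + q - x)).image (fun x => x - r)).card := by
    have hdet : det2 (p - r) (q - r) = orient p q r := by simp [orient, det2]; ring
    rw [← hdet]
    refine det2_le_card_of_box_subset (by rwa [hdet]) fun y h1 h2 h3 h4 => ?_
    obtain ⟨x, rfl⟩ : ∃ x, y = x - r := ⟨y + r, by simp⟩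
    refine Finset.mem_image_of_mem _ ?_
    have e1 : det2 (x - r) (q - r) = orient q r x := by simp [orient, det2]; ring
    have e2 : det2 (p - r) (x - r) = orient r p x := by simp [orient, det2]
    rw [e1] at h1; rw [e1, hdet] at h2; rw [e2] at h3; rw [e2, hdet] at h4
    have hs := hsum x
    rcases lt_trichotomy (orient p q x) 0 with h | h | h
    · refine Finset.mem_union_right _ (Finset.mem_image.2 ⟨p + q - x, ?_, by abel⟩)
      have f1 : orient p q (p + q - x) = -orient p q x := by simp [orient, det2]; ring
      have f2 : orient q r (p + q - x) = orient p q r - orient q r x := by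
        simp [orient, det2]; ring
      have f3 : orient r p (p + q - x) = orient p q r - orient r p x := by
        simp [orient, det2]; ring
      have g1 : 0 < orient p q (p + q - x) := by omega
      have g2 : 0 < orient q r (p + q - x) := by omega
      have g3 : 0 < orient r p (p + q - x) := by omega
      exact Finset.mem_filter.2 ⟨hL.mem_of_orient hp hq hr hD g1.le g2.le g3.le, g1, g2, g3⟩
    · refine Finset.mem_union_left _ (Finset.mem_union_right _ ((mem_openEdge_iff_orient hD).2 ?_))
      exact ⟨hL.mem_of_orient hp hq hr hD h.ge h1 h3, h, by omega, by omega⟩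
    · refine Finset.mem_union_left _ (Finset.mem_union_left _ (Finset.mem_filter.2 ?_))
      exact ⟨hL.mem_of_orient hp hq hr hD h.le h1 h3, h, h1, h3⟩
  have c1 := Finset.card_image_le (s := (triangleMinusBase L p q r ∪ openEdge L p q) ∪
      (openTriangle L p q r).image (fun x => p + q - x)) (f := fun x => x - r)
  have c2 := Finset.card_union_le (triangleMinusBase L p q r ∪ openEdge L p q)
      ((openTriangle L p q r).image (fun x => p + q - x))
  have c3 := Finset.card_union_le (triangleMinusBase L p q r) (openEdge L p q)
  have c4 := Finset.card_image_le (s := openTriangle L p q r) (f := fun x => p + q - x)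
  omega

/-- The points of `L` strictly to the left of the line from `p` to `q`. -/
def leftOf (L : Finset (ℤ × ℤ)) (p q : ℤ × ℤ) : Finset (ℤ × ℤ) :=
  L.filter fun x => 0 < orient p q x

/-- The value at `x` of the integer linear functional with coefficients `φ`. -/
def linFun (φ x : ℤ × ℤ) : ℤ := φ.1 * x.1 + φ.2 * x.2

theorem orient_add_one_le {L : Finset (ℤ × ℤ)} (hL : LatticeConvex L)
    {p q r : ℤ × ℤ} (hp : p ∈ L) (hq : q ∈ L) (hr : r ∈ L) (hD : 0 < orient p q r) :
    orient p q r + 1 ≤ 2 * (leftOf L p q).card + (openEdge L p q).card := by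
  have h := orient_le_card_triangleMinusBase hL hp hq hr hD
  have hsub : (triangleMinusBase L p q r).card ≤ (leftOf L p q).card :=
    Finset.card_le_card (Finset.monotone_filter_right _ fun _ _ hx => hx.1)
  omega

theorem orient_add_orient_add_two_le {L : Finset (ℤ × ℤ)} (hL : LatticeConvex L)
    {p q u v : ℤ × ℤ} (hp : p ∈ L) (hq : q ∈ L) (hu : u ∈ L) (hv : v ∈ L)
    (hqu : 0 < orient p q u) (hqv : 0 < orient p q v) (huv : 0 < orient p u v) :
    orient p q u + orient p u v + 2 ≤ 2 * (leftOf L p q).card + (openEdge L p q).card := by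
  have h1 := orient_le_card_triangleMinusBase hL hp hq hu hqu
  have h2 := orient_le_card_triangleMinusBase hL hp hu hv huv
  rw [openEdge_comm L u p] at h1
  have hdisj : Disjoint (triangleMinusBase L p q u) (triangleMinusBase L p u v) := by
    rw [Finset.disjoint_left]
    intro x hx hx'
    simp only [triangleMinusBase, Finset.mem_filter] at hx hx'
    have := orient_swap p u x
    omega
  have hsub : triangleMinusBase L p q u ∪ triangleMinusBase L p u v ⊆ leftOf L p q := by
    intro x hx
    rcases Finset.mem_union.1 hx with hx | hx
    · exact Finset.monotone_filter_right _ (fun _ _ h => h.1) hx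
    · simp only [triangleMinusBase, Finset.mem_filter] at hx
      refine Finset.mem_filter.2 ⟨hx.1, ?_⟩
      have key : orient p u v * orient p q x =
          orient v p x * orient p q u + orient p u x * orient p q v := by
        simp [orient, det2]; ring
      refine pos_of_mul_pos_right (a := orient p u v) ?_ huv.le
      rw [key]
      have := mul_nonneg hx.2.2.2 hqu.le
      have := mul_pos hx.2.1 hqv
      omega
  have hc := Finset.card_le_card hsub
  rw [Finset.card_union_of_disjoint hdisj] at hc
  omega

/-- If `φ` attains its minimum over `L` at `p` and its maximum at `q`, there is an upper bound `M`
for twice the area of the part of the polygon left of `p q` (tested on triangles and trapezia)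
which is controlled by the number of lattice points. -/
theorem exists_cap_bound {L : Finset (ℤ × ℤ)} (hL : LatticeConvex L)
    {p q : ℤ × ℤ} (hp : p ∈ L) (hq : q ∈ L) (φ : ℤ × ℤ) (hpq : linFun φ p < linFun φ q)
    (hmin : ∀ x ∈ L, linFun φ p ≤ linFun φ x) (hmax : ∀ x ∈ L, linFun φ x ≤ linFun φ q) :
    ∃ M : ℤ, 0 ≤ M ∧ (M = 0 ∨ M + 1 ≤ 2 * (leftOf L p q).card + (openEdge L p q).card) ∧
      (∀ x ∈ L, orient p q x ≤ M) ∧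
      ∀ u ∈ L, ∀ v ∈ L, 0 ≤ orient p q u → 0 ≤ orient p q v →
        orient p q u + orient p u v ≤ M := by
  obtain ⟨M, hM0, hM1, hM⟩ : ∃ M : ℤ, 0 ≤ M ∧
      (M = 0 ∨ M + 1 ≤ 2 * (leftOf L p q).card + (openEdge L p q).card) ∧
      ∀ t : ℤ, 0 < t → (leftOf L p q).Nonempty →
        t + 1 ≤ 2 * (leftOf L p q).card + (openEdge L p q).card → t ≤ M := by
    rcases Finset.eq_empty_or_nonempty (leftOf L p q) with h | h
    · exact ⟨0, le_rfl, Or.inl rfl, fun t _ hn => absurd h hn.ne_empty⟩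
    · have := h.card_pos
      exact ⟨2 * (leftOf L p q).card + (openEdge L p q).card - 1, by omega, Or.inr (by omega),
        fun t _ _ ht => by omega⟩
  have htri : ∀ x ∈ L, orient p q x ≤ M := by
    intro x hx
    rcases le_or_gt (orient p q x) 0 with h | h
    · omega
    · exact hM _ h ⟨x, Finset.mem_filter.2 ⟨hx, h⟩⟩ (orient_add_one_le hL hp hq hx h)
  refine ⟨M, hM0, hM1, htri, fun u hu v hv h1 h2 => ?_⟩
  have key : (linFun φ q - linFun φ p) * orient p u v =
      (linFun φ u - linFun φ p) * orient p q v - (linFun φ v - linFun φ p) * orient p q u := by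
    simp [orient, det2, linFun]; ring
  have hw : 0 < linFun φ q - linFun φ p := by omega
  have hu0 := hmin u hu
  have hv0 := hmin v hv
  have hu1 := hmax u hu
  rcases le_or_gt (orient p u v) 0 with h | h
  · have := htri u hu
    omega
  rcases h1.eq_or_lt with h1 | h1
  · have : (linFun φ q - linFun φ p) * orient p u v ≤
        (linFun φ q - linFun φ p) * orient p q v := by
      rw [key, ← h1]; nlinarith
    have := le_of_mul_le_mul_left this hw
    have := htri v hv
    omega
  rcases h2.eq_or_lt with h2 | h2
  · have : (linFun φ q - linFun φ p) * orient p u v ≤ 0 := by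
      rw [key, ← h2]; nlinarith
    nlinarith
  · have := orient_add_orient_add_two_le hL hp hq hu hv h1 h2 h
    exact hM _ (by omega) ⟨u, Finset.mem_filter.2 ⟨hu, h1⟩⟩ (by omega)

theorem card_leftOf_add_card_openEdge_le {L : Finset (ℤ × ℤ)} {p q : ℤ × ℤ} (hp : p ∈ L)
    (hq : q ∈ L) (hpq : p ≠ q) :
    (leftOf L p q).card + (leftOf L q p).card + (openEdge L p q).card + 2 ≤ L.card := by
  have hzero : ∀ x ∈ openEdge L p q, orient p q x = 0 := by
    intro x hx
    obtain ⟨-, a, b, ha, hb, e⟩ := mem_openEdge.1 hx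
    have h1 := congrArg Prod.fst e
    have h2 := congrArg Prod.snd e
    simp only [Prod.fst_add, Prod.smul_fst, Prod.snd_add, Prod.smul_snd, smul_eq_mul] at h1 h2
    refine (mul_eq_zero.1 (?_ : (a + b) * orient p q x = 0)).resolve_left (by omega)
    simp only [orient, det2, Prod.fst_sub, Prod.snd_sub]
    linear_combination (q.1 - p.1) * h2 - (q.2 - p.2) * h1
  have hend : ∀ {p q : ℤ × ℤ}, p ≠ q → p ∉ openEdge L p q := by
    intro p q hpq hx
    obtain ⟨-, a, b, ha, hb, e⟩ := mem_openEdge.1 hx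
    rw [add_smul, add_right_inj] at e
    exact hpq (smul_right_injective _ hb.ne' e)
  have hself : ∀ p q : ℤ × ℤ, orient p q p = 0 ∧ orient p q q = 0 := fun p q => by
    simp [orient, det2, mul_comm]
  rw [← Finset.card_pair hpq, ← Finset.card_union_of_disjoint, ← Finset.card_union_of_disjoint,
    ← Finset.card_union_of_disjoint]
  · refine Finset.card_le_card fun x hx => ?_
    simp only [leftOf, mem_openEdge, Finset.mem_union, Finset.mem_filter, Finset.mem_insert,
      Finset.mem_singleton] at hx
    rcases hx with ((h | h) | h) | rfl | rfl
    exacts [h.1, h.1, h.1, hp, hq]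
  · rw [Finset.disjoint_right]
    intro x hx hx'
    simp only [leftOf, Finset.mem_union, Finset.mem_filter] at hx'
    rcases Finset.mem_insert.1 hx with rfl | hx
    · have := hself x q
      have := hself q x
      have := hend hpq
      grind
    · obtain rfl := Finset.mem_singleton.1 hx
      have := hself x p
      have := hself p x
      have := hend hpq.symm
      rw [openEdge_comm] at this
      grind
  · rw [Finset.disjoint_right]
    intro x hx hx'
    have := hzero x hx
    have := orient_swap p q x
    simp only [leftOf, Finset.mem_union, Finset.mem_filter] at hx'
    omega
  · rw [Finset.disjoint_right]
    intro x hx hx'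
    have := orient_swap p q x
    simp only [leftOf, Finset.mem_filter] at hx hx'
    omega

/-- The inequality behind the area bound: `a`, `a'`, `b`, `b'` are the abscissae of four points in a
strip of width `w`, and `α`, `α'`, `β`, `β'` their heights above or below a chord of slope `m / w`. -/
theorem three_mul_sq_le_four_mul_of_heights {w m a a' b b' α α' β β' M N : ℤ} (hw : 0 < w)
    (hm : 0 ≤ m) (hmw : m < w) (ha' : 0 ≤ a') (haw : a ≤ w) (hb : 0 ≤ b)
    (hbw : b' ≤ w) (hα : 0 ≤ α) (hα' : 0 ≤ α') (hβ : 0 ≤ β) (hβ' : 0 ≤ β')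
    (hY : w ^ 2 - m * (a - b) ≤ α + β) (hZ : w ^ 2 - (w - m) * (b' - a') ≤ α' + β')
    (hαM : α ≤ M) (hα'M : α' ≤ M) (hβN : β ≤ N) (hβ'N : β' ≤ N)
    (hM : α * (w - a') + α' * a ≤ w * M) (hN : β * b' + β' * (w - b) ≤ w * N) :
    3 * w ^ 2 ≤ 4 * (M + N) := by
  rcases le_or_gt (a - b) 0 with hc | hc
  · nlinarith [mul_nonneg hm (neg_nonneg.2 hc)]
  rcases le_or_gt (b' - a') 0 with hc' | hc'
  · nlinarith [mul_nonneg (sub_nonneg.2 hmw.le) (neg_nonneg.2 hc')]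
  obtain ⟨c, hcd⟩ : ∃ c, c = a - b := ⟨_, rfl⟩
  obtain ⟨c', hcd'⟩ : ∃ c', c' = b' - a' := ⟨_, rfl⟩
  rw [← hcd] at hc hY
  rw [← hcd'] at hc' hZ
  refine le_of_mul_le_mul_left (a := w) ?_ hw
  rcases le_or_gt (c + c') w with hs | hs
  · have h1 : (w - m) * (w ^ 2 - m * c) ≤ (w - m) * (M + N) :=
      mul_le_mul_of_nonneg_left (by omega) (by omega)
    have h2 : m * (w ^ 2 - (w - m) * c') ≤ m * (M + N) :=
      mul_le_mul_of_nonneg_left (by omega) (by omega)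
    have h3 : m * (w - m) * (c + c') ≤ m * (w - m) * w :=
      mul_le_mul_of_nonneg_left hs (mul_nonneg hm (by omega))
    nlinarith [mul_nonneg hw.le (sq_nonneg (w - 2 * m))]
  · have h1 : c' * (w ^ 2 - m * c) ≤ c' * (α + β) := mul_le_mul_of_nonneg_left hY hc'.le
    have h2 : c * (w ^ 2 - (w - m) * c') ≤ c * (α' + β') := mul_le_mul_of_nonneg_left hZ hc.le
    have g1 : α * c' ≤ α * (w - a') := mul_le_mul_of_nonneg_left (by omega) hα
    have g2 : α' * c ≤ α' * a := mul_le_mul_of_nonneg_left (by omega) hα'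
    have g3 : β * c' ≤ β * b' := mul_le_mul_of_nonneg_left (by omega) hβ
    have g4 : β' * c ≤ β' * (w - b) := mul_le_mul_of_nonneg_left (by omega) hβ'
    have h3 : w * (w ^ 2 - (w - c) * (w - c')) ≤ w * (M + N) := by nlinarith
    have h4 : 4 * ((w - c) * (w - c')) ≤ w ^ 2 := by
      have hcw : c ≤ w := by omega
      have hcw' : c' ≤ w := by omega
      nlinarith [sq_nonneg (c - c')]
    nlinarith [mul_le_mul_of_nonneg_left h4 hw.le]

theorem linFun_smul (d : ℤ) (φ x : ℤ × ℤ) : linFun (d • φ) x = d * linFun φ x := by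
  simp [linFun]; ring

theorem isCoprime_of_width_minimal {L : Finset (ℤ × ℤ)} {w : ℤ} (hw : 0 < w) {φ : ℤ × ℤ}
    (hφ0 : φ ≠ 0) (hφ : ∀ x ∈ L, ∀ y ∈ L, linFun φ x - linFun φ y ≤ w)
    (hwid : ∀ ψ : ℤ × ℤ, ψ ≠ 0 → ∃ x ∈ L, ∃ y ∈ L, w ≤ linFun ψ x - linFun ψ y) :
    IsCoprime φ.1 φ.2 := by
  obtain ⟨a, ha⟩ := Int.gcd_dvd_left φ.1 φ.2
  obtain ⟨b, hb⟩ := Int.gcd_dvd_right φ.1 φ.2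
  have hψ : φ = (φ.1.gcd φ.2 : ℤ) • ((a, b) : ℤ × ℤ) := Prod.ext ha hb
  have hψ0 : ((a, b) : ℤ × ℤ) ≠ 0 := fun h => hφ0 (by rw [hψ, h, smul_zero])
  obtain ⟨x, hx, y, hy, hxy⟩ := hwid _ hψ0
  have h := hφ x hx y hy
  rw [hψ, linFun_smul, linFun_smul, ← mul_sub] at h
  have h0 : φ.1.gcd φ.2 ≠ 0 := fun h0 => hφ0 (by rw [hψ, h0]; simp)
  rw [Int.isCoprime_iff_gcd_eq_one]
  by_contra h1
  have : (2 : ℤ) ≤ φ.1.gcd φ.2 := by omega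
  nlinarith

theorem three_mul_sq_le_of_width_minimal {L : Finset (ℤ × ℤ)} (hL : LatticeConvex L)
    (hcard : 3 ≤ L.card) {w : ℤ} (hw : 0 < w) {φ : ℤ × ℤ}
    (hφ0 : φ ≠ 0) (hφ : ∀ x ∈ L, ∀ y ∈ L, linFun φ x - linFun φ y ≤ w)
    (hwid : ∀ ψ : ℤ × ℤ, ψ ≠ 0 → ∃ x ∈ L, ∃ y ∈ L, w ≤ linFun ψ x - linFun ψ y) :
    3 * w ^ 2 ≤ 8 * (L.card : ℤ) - 20 := by
  obtain ⟨s, t, hst⟩ := isCoprime_of_width_minimal hw hφ0 hφ hwid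
  obtain ⟨q, hq, p, hp, hqp⟩ := hwid φ hφ0
  have hqp' : linFun φ q - linFun φ p = w := le_antisymm (hφ q hq p hp) hqp
  have hmin : ∀ x ∈ L, linFun φ p ≤ linFun φ x := fun x hx => by have := hφ q hq x hx; omega
  have hmax : ∀ x ∈ L, linFun φ x ≤ linFun φ q := fun x hx => by have := hφ x hx p hp; omega
  -- a functional completing `φ` to a basis, normalised on `q - p`
  obtain ⟨ψ, hdet, hm, hmw⟩ : ∃ ψ : ℤ × ℤ, φ.1 * ψ.2 - φ.2 * ψ.1 = 1 ∧
      0 ≤ linFun ψ q - linFun ψ p ∧ linFun ψ q - linFun ψ p < w := by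
    set n := linFun (-t, s) q - linFun (-t, s) p
    refine ⟨(-t, s) - (n / w) • φ, ?_, ?_⟩
    · simp only [Prod.fst_sub, Prod.snd_sub, Prod.smul_fst, Prod.smul_snd, smul_eq_mul]
      linear_combination hst
    · have : linFun ((-t, s) - (n / w) • φ) q - linFun ((-t, s) - (n / w) • φ) p = n % w := by
        rw [Int.emod_def, ← hqp']
        simp only [linFun, n, Prod.fst_sub, Prod.snd_sub, Prod.smul_fst, Prod.smul_snd, smul_eq_mul]
        ring
      rw [this]
      exact ⟨Int.emod_nonneg _ hw.ne', Int.emod_lt_of_pos _ hw⟩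
  obtain ⟨m, hmd⟩ : ∃ m, m = linFun ψ q - linFun ψ p := ⟨_, rfl⟩
  rw [← hmd] at hm hmw
  have hH : ∀ x, orient p q x =
      w * (linFun ψ x - linFun ψ p) - m * (linFun φ x - linFun φ p) := by
    intro x
    rw [hmd, ← hqp', ← one_mul (orient p q x), ← hdet]
    simp only [linFun, orient, det2, Prod.fst_sub, Prod.snd_sub]
    ring
  have hψ0 : ψ ≠ 0 := by rintro rfl; simp at hdet
  have hψφ0 : ψ - φ ≠ 0 := by
    intro h; rw [sub_eq_zero.1 h] at hdet; linarith [mul_comm φ.1 φ.2]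
  have hsub : ∀ x, linFun (ψ - φ) x = linFun ψ x - linFun φ x := fun x => by
    simp [linFun]; ring
  have hp0 : orient p q p = 0 := by simp [orient, det2]
  have hq0 : orient p q q = 0 := by simp [orient, det2, mul_comm]
  obtain ⟨A, hA, B, hB, hAB, hA0, hB0⟩ : ∃ A ∈ L, ∃ B ∈ L,
      w ≤ linFun ψ A - linFun ψ B ∧ 0 ≤ orient p q A ∧ orient p q B ≤ 0 := by
    obtain ⟨A, hA, B, hB, hAB⟩ := hwid ψ hψ0
    obtain ⟨A₁, hA₁, hAA, h1⟩ : ∃ A₁ ∈ L, linFun ψ A ≤ linFun ψ A₁ ∧ 0 ≤ orient p q A₁ := by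
      rcases le_or_gt 0 (orient p q A) with h | h
      · exact ⟨A, hA, le_rfl, h⟩
      · refine ⟨q, hq, ?_, hq0.ge⟩
        rw [hH] at h
        have := hmax A hA
        nlinarith
    obtain ⟨B₁, hB₁, hBB, h2⟩ : ∃ B₁ ∈ L, linFun ψ B₁ ≤ linFun ψ B ∧ orient p q B₁ ≤ 0 := by
      rcases le_or_gt (orient p q B) 0 with h | h
      · exact ⟨B, hB, le_rfl, h⟩
      · refine ⟨p, hp, ?_, hp0.le⟩
        rw [hH] at h
        have := hmin B hB
        nlinarith
    exact ⟨A₁, hA₁, B₁, hB₁, by omega, h1, h2⟩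
  obtain ⟨A', hA', B', hB', hAB', hA0', hB0'⟩ : ∃ A ∈ L, ∃ B ∈ L,
      w ≤ linFun (ψ - φ) A - linFun (ψ - φ) B ∧ 0 ≤ orient p q A ∧ orient p q B ≤ 0 := by
    obtain ⟨A, hA, B, hB, hAB⟩ := hwid (ψ - φ) hψφ0
    simp only [hsub] at hAB ⊢
    obtain ⟨A₁, hA₁, hAA, h1⟩ : ∃ A₁ ∈ L,
        linFun ψ A - linFun φ A ≤ linFun ψ A₁ - linFun φ A₁ ∧ 0 ≤ orient p q A₁ := by
      rcases le_or_gt 0 (orient p q A) with h | h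
      · exact ⟨A, hA, le_rfl, h⟩
      · refine ⟨p, hp, ?_, hp0.ge⟩
        rw [hH] at h
        have := hmin A hA
        nlinarith
    obtain ⟨B₁, hB₁, hBB, h2⟩ : ∃ B₁ ∈ L,
        linFun ψ B₁ - linFun φ B₁ ≤ linFun ψ B - linFun φ B ∧ orient p q B₁ ≤ 0 := by
      rcases le_or_gt (orient p q B) 0 with h | h
      · exact ⟨B, hB, le_rfl, h⟩
      · refine ⟨q, hq, ?_, hq0.le⟩
        rw [hH] at h
        have := hmax B hB
        nlinarith
    exact ⟨A₁, hA₁, B₁, hB₁, by omega, h1, h2⟩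
  have hpq : linFun φ p < linFun φ q := by omega
  have hneg : ∀ x, linFun (-φ) x = -linFun φ x := fun x => by simp [linFun]; ring
  obtain ⟨M, hM0, hM1, hMtri, hMtrap⟩ := exists_cap_bound hL hp hq φ hpq hmin hmax
  obtain ⟨N, hN0, hN1, hNtri, hNtrap⟩ := exists_cap_bound hL hq hp (-φ)
    (by simpa only [hneg, neg_lt_neg_iff] using hpq)
    (by simpa only [hneg, neg_le_neg_iff] using hmax)
    (by simpa only [hneg, neg_le_neg_iff] using hmin)
  have hcount := card_leftOf_add_card_openEdge_le hp hq (by rintro rfl; omega)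
  rw [openEdge_comm L q p] at hN1
  have hMN : M + N ≤ 2 * (L.card : ℤ) - 5 := by omega
  have hswap := orient_swap p q
  have harea : 3 * w ^ 2 ≤ 4 * (M + N) := by
    refine three_mul_sq_le_four_mul_of_heights (m := m)
      (a := linFun φ A - linFun φ p) (a' := linFun φ A' - linFun φ p)
      (b := linFun φ B - linFun φ p) (b' := linFun φ B' - linFun φ p)
      (α := orient p q A) (α' := orient p q A') (β := orient q p B) (β' := orient q p B')
      hw hm hmw ?_ ?_ ?_ ?_ hA0 hA0' ?_ ?_ ?_ ?_ (hMtri A hA) (hMtri A' hA')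
      (hNtri B hB) (hNtri B' hB') ?_ ?_
    · have := hmin A' hA'; omega
    · have := hmax A hA; omega
    · have := hmin B hB; omega
    · have := hmax B' hB'; omega
    · have := hswap B; omega
    · have := hswap B'; omega
    · rw [hswap, hH, hH]; nlinarith
    · rw [hswap, hH, hH]
      rw [hsub, hsub] at hAB'
      nlinarith
    · refine le_trans (le_of_eq ?_)
        (mul_le_mul_of_nonneg_left (hMtrap A hA A' hA' hA0 hA0') hw.le)
      rw [← hqp']
      simp only [orient, det2, linFun, Prod.fst_sub, Prod.snd_sub]
      ring
    · refine le_trans (le_of_eq ?_) (mul_le_mul_of_nonneg_left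
        (hNtrap B hB B' hB' (by rw [hswap]; omega) (by rw [hswap]; omega)) hw.le)
      rw [← hqp']
      simp only [orient, det2, linFun, Prod.fst_sub, Prod.snd_sub]
      ring
  omega

theorem latticeConvex_of_convex {P : Set (ℝ × ℝ)} (hP : Convex ℝ P) {L : Finset (ℤ × ℤ)}
    (hL : ∀ x, x ∈ L ↔ x ∈ latticePoints P) : LatticeConvex L := by
  intro p hp q hq r hr a b c ha hb hc habc x hx
  rw [hL] at hp hq hr ⊢
  have hs : (0 : ℝ) < a + b + c := by exact_mod_cast habc
  have ha' : (0 : ℝ) ≤ a := by exact_mod_cast ha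
  have hb' : (0 : ℝ) ≤ b := by exact_mod_cast hb
  have hc' : (0 : ℝ) ≤ c := by exact_mod_cast hc
  have hx1 : ((a : ℝ) + b + c) * x.1 = a * p.1 + b * q.1 + c * r.1 := by
    exact_mod_cast congrArg Prod.fst hx
  have hx2 : ((a : ℝ) + b + c) * x.2 = a * p.2 + b * q.2 + c * r.2 := by
    exact_mod_cast congrArg Prod.snd hx
  have key : toReal2 x = ∑ i : Fin 3, (![(a : ℝ), b, c] i / (a + b + c)) •
      ![toReal2 p, toReal2 q, toReal2 r] i := by
    simp only [Fin.sum_univ_three, toReal2]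
    ext
    · simp; field_simp; linarith
    · simp; field_simp; linarith
  change toReal2 x ∈ P
  rw [key]
  refine hP.sum_mem (fun i _ => ?_) ?_ (fun i _ => ?_)
  · fin_cases i <;> simp <;> positivity
  · simp [Fin.sum_univ_three]; field_simp
  · fin_cases i
    exacts [hp, hq, hr]

theorem dirWidth_eq (P : Set (ℝ × ℝ)) (φ : ℤ × ℤ) :
    dirWidth P φ = sSup (linFun φ '' latticePoints P) - sInf (linFun φ '' latticePoints P) := rfl

theorem linFun_sub_le_dirWidth {P : Set (ℝ × ℝ)} (hfin : (latticePoints P).Finite) (φ : ℤ × ℤ)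
    {x y : ℤ × ℤ} (hx : x ∈ latticePoints P) (hy : y ∈ latticePoints P) :
    linFun φ x - linFun φ y ≤ dirWidth P φ := by
  rw [dirWidth_eq]
  exact sub_le_sub (le_csSup (hfin.image _).bddAbove ⟨x, hx, rfl⟩)
    (csInf_le (hfin.image _).bddBelow ⟨y, hy, rfl⟩)

theorem exists_dirWidth_eq {P : Set (ℝ × ℝ)} (hfin : (latticePoints P).Finite)
    (hne : (latticePoints P).Nonempty) (φ : ℤ × ℤ) :
    ∃ x ∈ latticePoints P, ∃ y ∈ latticePoints P, dirWidth P φ = linFun φ x - linFun φ y := by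
  obtain ⟨x, hx, hmax⟩ := (hne.image (linFun φ)).csSup_mem (hfin.image _)
  obtain ⟨y, hy, hmin⟩ := (hne.image (linFun φ)).csInf_mem (hfin.image _)
  exact ⟨x, hx, y, hy, by rw [dirWidth_eq, hmax, hmin]⟩

/-- If `P` is a convex lattice polygon containing exactly `g ≥ 3` lattice
points in total, then `3·lw(P)² ≤ 8g − 20`, i.e. `lw(P) ≤ √((8/3)(g − 5/2))`. -/
theorem three_mul_latticeWidth_sq_le (S : Finset (ℤ × ℤ)) (P : Set (ℝ × ℝ))
    (hP : P = convexHull ℝ (toReal2 '' (S : Set (ℤ × ℤ))))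
    (g : ℕ) (hg : (latticePoints P).ncard = g) (hg3 : 3 ≤ g) :
    3 * latticeWidth P ^ 2 ≤ 8 * (g : ℤ) - 20 := by
  have hfin : (latticePoints P).Finite := Set.finite_of_ncard_ne_zero (by omega)
  have hne : (latticePoints P).Nonempty := Set.nonempty_of_ncard_ne_zero (by omega)
  have hcard : hfin.toFinset.card = g := by rw [← hg, Set.ncard_eq_toFinset_card _ hfin]
  have hconv : LatticeConvex hfin.toFinset :=
    latticeConvex_of_convex (hP ▸ convex_convexHull ℝ _) fun x => hfin.mem_toFinset
  have hnonneg : ∀ φ, 0 ≤ dirWidth P φ := fun φ => by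
    obtain ⟨x, hx⟩ := hne
    simpa using linFun_sub_le_dirWidth hfin φ hx hx
  have hbdd : BddBelow {w | ∃ φ : ℤ × ℤ, φ ≠ 0 ∧ w = dirWidth P φ} :=
    ⟨0, by rintro _ ⟨φ, -, rfl⟩; exact hnonneg φ⟩
  obtain ⟨φ, hφ0, hφ⟩ : latticeWidth P ∈ {w | ∃ φ : ℤ × ℤ, φ ≠ 0 ∧ w = dirWidth P φ} :=
    Int.csInf_mem ⟨_, (1, 0), by simp, rfl⟩ hbdd
  rcases (hφ ▸ hnonneg φ : 0 ≤ latticeWidth P).eq_or_lt with hw | hw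
  · rw [← hw]; omega
  rw [← hcard]
  refine three_mul_sq_le_of_width_minimal hconv (by omega) hw hφ0 (fun x hx y hy => ?_)
    fun ψ hψ => ?_
  · rw [hφ]
    exact linFun_sub_le_dirWidth hfin φ (hfin.mem_toFinset.1 hx) (hfin.mem_toFinset.1 hy)
  · obtain ⟨x, hx, y, hy, h⟩ := exists_dirWidth_eq hfin hne ψ
    exact ⟨x, hfin.mem_toFinset.2 hx, y, hfin.mem_toFinset.2 hy,
      h ▸ csInf_le hbdd ⟨ψ, hψ, rfl⟩⟩
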